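/- arXiv:1607.05997 — 3 statements merged into one kernel-verified Lean document; each statement's English description precedes it below -/
import Mathlib

section
/- Every non-anomalous totally ordered semigroup is Archimedean. -/
/-- `mpow x n` is the `n`-fold product `xⁿ` of `x` with itself, for `n ≥ 1`
(the value at `n = 0` is a junk value, never used below). -/
def mpow {S : Type*} [Mul S] (x : S) : ℕ → S
  | 0 => x
  | 1 => x
  | n + 2 => mpow x (n + 1) * x

/-- `x, y` with `x > y` form an anomalous pair if `xⁿ < y^(n+1)` for every `n ≥ 1`,
or `yⁿ > x^(n+1)` for every `n ≥ 1`. -/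
def IsAnomalousPair {S : Type*} [Mul S] [LT S] (x y : S) : Prop :=
  y < x ∧ ((∀ n : ℕ, 1 ≤ n → mpow x n < mpow y (n + 1)) ∨
           (∀ n : ℕ, 1 ≤ n → mpow x (n + 1) < mpow y n))

section MPow

variable {S : Type*} [Semigroup S]

theorem mpow_succ (x : S) {n : ℕ} (hn : 1 ≤ n) : mpow x (n + 1) = mpow x n * x := by
  obtain ⟨m, rfl⟩ := Nat.exists_eq_add_of_le' hn
  rfl

theorem mpow_succ' (x : S) {n : ℕ} (hn : 1 ≤ n) : mpow x (n + 1) = x * mpow x n := by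
  induction n, hn using Nat.le_induction with
  | base => rfl
  | succ n hn ih => rw [mpow_succ x (Nat.le_succ_of_le hn), ih, mul_assoc, ← mpow_succ x hn, ih]

theorem mpow_toDual (x : S) (n : ℕ) :
    mpow (OrderDual.toDual x) n = OrderDual.toDual (mpow x n) := by
  rcases n with _ | n
  · rfl
  · induction n with
    | zero => rfl
    | succ n ih => exact congrArg (· * OrderDual.toDual x) ih

variable [LinearOrder S]

theorem IsAnomalousPair.ofDual {x y : S}
    (h : IsAnomalousPair (OrderDual.toDual x) (OrderDual.toDual y)) : IsAnomalousPair y x := by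
  simpa only [IsAnomalousPair, mpow_toDual, OrderDual.toDual_lt_toDual, or_comm] using h

theorem mpow_mul_le_mul_mpow [MulLeftMono S] [MulRightMono S] {a b : S} (h : a * b ≤ b * a)
    {n : ℕ} (hn : 1 ≤ n) : mpow a n * b ≤ b * mpow a n := by
  induction n, hn using Nat.le_induction with
  | base => exact h
  | succ n hn ih =>
    calc mpow a (n + 1) * b = mpow a n * (a * b) := by rw [mpow_succ a hn, mul_assoc]
      _ ≤ mpow a n * (b * a) := by gcongr
      _ = mpow a n * b * a := (mul_assoc _ _ _).symm
      _ ≤ b * mpow a n * a := by gcongr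
      _ = b * mpow a (n + 1) := by rw [mpow_succ a hn, mul_assoc]

theorem mul_mpow_le_mpow_mul_mpow [MulLeftMono S] [MulRightMono S] {a b : S}
    (h : a * b ≤ b * a) {n : ℕ} (hn : 1 ≤ n) : mpow (a * b) n ≤ mpow b n * mpow a n := by
  induction n, hn using Nat.le_induction with
  | base => exact h
  | succ n hn ih =>
    calc mpow (a * b) (n + 1) = mpow (a * b) n * (a * b) := mpow_succ _ hn
      _ ≤ mpow b n * mpow a n * (a * b) := by gcongr
      _ = mpow b n * (mpow a (n + 1) * b) := by rw [mpow_succ a hn]; simp only [mul_assoc]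
      _ ≤ mpow b n * (b * mpow a (n + 1)) :=
        mul_le_mul_right (mpow_mul_le_mul_mpow h (Nat.le_succ_of_le hn)) _
      _ = mpow b (n + 1) * mpow a (n + 1) := by rw [mpow_succ b hn, mul_assoc]

/-- If every power of a positive `y` is at most `x`, then one of `x * y`, `y * x` forms an
anomalous pair with `x`. -/
theorem exists_isAnomalousPair_of_forall_mpow_le
    (hmul : ∀ x y z : S, x < y → x * z < y * z ∧ z * x < z * y) {x y : S} (hy : y < y * y)
    (hxy : ∀ n : ℕ, 1 ≤ n → mpow y n ≤ x) : ∃ z, IsAnomalousPair z x := by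
  have : MulLeftStrictMono S := ⟨fun z _ _ h => (hmul _ _ z h).2⟩
  have : MulRightStrictMono S := ⟨fun z _ _ h => (hmul _ _ z h).1⟩
  have : MulLeftMono S := mulLeftMono_of_mulLeftStrictMono S
  have : MulRightMono S := mulRightMono_of_mulRightStrictMono S
  have lt_left (z : S) : z < y * z := by
    by_contra! h
    have h₁ : y * (y * z) ≤ y * z := by gcongr
    exact h₁.not_gt (by rw [← mul_assoc]; exact (hmul _ _ z hy).1)
  have lt_right (z : S) : z < z * y := by
    by_contra! h
    have h₁ : z * y * y ≤ z * y := by gcongr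
    exact h₁.not_gt (by rw [mul_assoc]; exact (hmul _ _ z hy).2)
  have mpow_lt {n : ℕ} (hn : 1 ≤ n) : mpow y n < x :=
    (lt_right _).trans_le (mpow_succ y hn ▸ hxy (n + 1) (Nat.le_succ_of_le hn))
  rcases le_total (x * y) (y * x) with h | h
  · refine ⟨x * y, lt_right x, Or.inl fun n hn => ?_⟩
    rw [mpow_succ' x hn]
    exact (mul_mpow_le_mpow_mul_mpow h hn).trans_lt (hmul _ _ _ (mpow_lt hn)).1
  · refine ⟨y * x, lt_left x, Or.inl fun n hn => ?_⟩
    rw [mpow_succ x hn]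
    exact (mul_mpow_le_mpow_mul_mpow h hn).trans_lt (hmul _ _ _ (mpow_lt hn)).2

end MPow

/-- Every non-anomalous totally ordered semigroup is Archimedean: for all positive
`x, y` there is `n ≥ 1` with `x < yⁿ`, and for all negative `x, y` there is `n ≥ 1`
with `x > yⁿ`. -/
theorem stmt2 {S : Type*} [Semigroup S] [LinearOrder S]
    (hmul : ∀ x y z : S, x < y → x * z < y * z ∧ z * x < z * y)
    (hna : ∀ x y : S, ¬ IsAnomalousPair x y) :
    (∀ x y : S, x < x * x → y < y * y → ∃ n : ℕ, 1 ≤ n ∧ x < mpow y n) ∧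
    (∀ x y : S, x * x < x → y * y < y → ∃ n : ℕ, 1 ≤ n ∧ mpow y n < x) := by
  refine ⟨fun x y _ hy => ?_, fun x y _ hy => ?_⟩
  · by_contra! h
    obtain ⟨z, hz⟩ := exists_isAnomalousPair_of_forall_mpow_le hmul hy h
    exact hna _ _ hz
  · by_contra! h
    obtain ⟨z, hz⟩ := exists_isAnomalousPair_of_forall_mpow_le (S := Sᵒᵈ)
      (x := OrderDual.toDual x) (y := OrderDual.toDual y) (fun x y z hxy => hmul y x z hxy) hy
      fun n hn => (mpow_toDual y n).symm ▸ h n hn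
    exact hna _ _ (IsAnomalousPair.ofDual (x := OrderDual.ofDual z) hz)
end

section
/- Let A be a non-anomalous commutative totally ordered additive semigroup and a ∈ A a non-identity element. Then there is exactly one morphism f from the additive semigroup of positive natural numbers {1, 2, 3, ...} (with its usual order) to A satisfying f(1) = a, namely f(n) = n•a. -/
/-- `nsm a n` is the `n`-fold sum `n • a` of `a` with itself, for `n ≥ 1`
(the value at `n = 0` is a junk value, never used below). -/
def nsm {A : Type*} [Add A] (a : A) : ℕ → A
  | 0 => a
  | 1 => a
  | n + 2 => nsm a (n + 1) + a

/-- `x, y` with `x > y` form an anomalous pair if `n•x < (n+1)•y` for every `n ≥ 1`,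
or `n•y > (n+1)•x` for every `n ≥ 1`. -/
def IsAddAnomalousPair {A : Type*} [Add A] [LT A] (x y : A) : Prop :=
  y < x ∧ ((∀ n : ℕ, 1 ≤ n → nsm x n < nsm y (n + 1)) ∨
           (∀ n : ℕ, 1 ≤ n → nsm x (n + 1) < nsm y n))

/-- A morphism of totally ordered additive semigroups: an additive map that is
either strictly monotone or strictly antitone. -/
def IsMorphism {A B : Type*} [Add A] [Add B] [Preorder A] [Preorder B] (f : A → B) : Prop :=
  (∀ x y : A, f (x + y) = f x + f y) ∧ (StrictMono f ∨ StrictAnti f)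

theorem nsm_succ {A : Type*} [Add A] (a : A) {n : ℕ} (hn : 1 ≤ n) :
    nsm a (n + 1) = nsm a n + a := by
  obtain ⟨k, rfl⟩ := Nat.exists_eq_add_of_le' hn
  rfl

theorem nsm_add {A : Type*} [AddSemigroup A] (a : A) {m n : ℕ} (hm : 1 ≤ m) (hn : 1 ≤ n) :
    nsm a (m + n) = nsm a m + nsm a n := by
  induction n, hn using Nat.le_induction with
  | base => exact nsm_succ a hm
  | succ n hn ih => rw [← add_assoc, nsm_succ a (by omega), ih, nsm_succ a hn, add_assoc]

theorem nsm_rel_succ {A : Type*} [Add A] (r : A → A → Prop)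
    (hr : ∀ x y z : A, r x y → r (x + z) (y + z)) {a : A} (ha : r a (a + a)) {n : ℕ}
    (hn : 1 ≤ n) : r (nsm a n) (nsm a (n + 1)) := by
  induction n, hn using Nat.le_induction with
  | base => exact ha
  | succ n hn ih =>
    have h := hr _ _ a ih
    rwa [← nsm_succ a hn, ← nsm_succ a (by omega)] at h

theorem nsm_rel_of_lt {A : Type*} [Add A] (r : A → A → Prop) [IsTrans A r]
    (hr : ∀ x y z : A, r x y → r (x + z) (y + z)) {a : A} (ha : r a (a + a)) {m n : ℕ}
    (hm : 1 ≤ m) (hmn : m < n) : r (nsm a m) (nsm a n) := by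
  induction n, hmn using Nat.le_induction with
  | base => exact nsm_rel_succ r hr ha hm
  | succ n hn ih => exact _root_.trans ih (nsm_rel_succ r hr ha (by omega))

theorem eq_nsm_of_map_add {A : Type*} [Add A] {f : ℕ+ → A}
    (hf : ∀ m n : ℕ+, f (m + n) = f m + f n) (n : ℕ+) : f n = nsm (f 1) n.val := by
  induction n using PNat.recOn with
  | one => rfl
  | succ n ih =>
    rw [hf, ih]
    exact (nsm_succ (f 1) n.pos).symm

/-- There is exactly one morphism from the positive natural numbers `ℕ+` to a
non-anomalous commutative totally ordered additive semigroup `A` sending `1` to a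
given non-identity element `a`, namely `n ↦ n • a`. -/
theorem stmt9 {A : Type*} [AddCommSemigroup A] [LinearOrder A]
    (hadd : ∀ x y z : A, x < y → x + z < y + z)
    (hna : ∀ x y : A, ¬ IsAddAnomalousPair x y)
    (a : A) (ha : a + a ≠ a) :
    (IsMorphism (fun n : ℕ+ => nsm a n.val) ∧ (fun n : ℕ+ => nsm a n.val) 1 = a) ∧
    ∀ f : ℕ+ → A, IsMorphism f → f 1 = a → f = fun n : ℕ+ => nsm a n.val := by
  refine ⟨⟨⟨fun m n => nsm_add a m.pos n.pos, ?_⟩, rfl⟩, fun f hf h1 => ?_⟩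
  · rcases lt_or_gt_of_ne ha with h | h
    · exact Or.inr fun m n hmn =>
        nsm_rel_of_lt (· > ·) (fun x y z hxy => hadd y x z hxy) h m.pos hmn
    · exact Or.inl fun m n hmn => nsm_rel_of_lt (· < ·) hadd h m.pos hmn
  · subst h1
    exact funext (eq_nsm_of_map_add hf.1)
end

section
/- Let A be a non-anomalous commutative totally ordered additive semigroup, a ∈ A a non-identity element, and r a nonzero real number. Then there exists exactly one morphism f : A → ℝ (with ℝ as an additive ordered semigroup) such that f(a) = r. (Thus the reals, pointed at any nonzero element, form a terminal object among pointed non-anomalous semigroups.) -/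
theorem map_nsm {A B : Type*} [Add A] [AddMonoid B] {f : A → B}
    (hf : ∀ x y, f (x + y) = f x + f y) (x : A) : ∀ n : ℕ, 1 ≤ n → f (nsm x n) = n • f x
  | 1, _ => by simp [nsm]
  | n + 2, _ => by rw [nsm, hf, map_nsm hf x (n + 1) (by omega), succ_nsmul _ (n + 1)]

section Difference

variable {A : Type*} [AddCommSemigroup A] [LinearOrder A] [IsCancelAdd A] [AddLeftMono A]

theorem difference_le_trans {x y x' y' x'' y'' : A} (h : x + y' ≤ x' + y)
    (h' : x' + y'' ≤ x'' + y') : x + y'' ≤ x'' + y := by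
  have key : (x + y'') + (x' + y') ≤ (x'' + y) + (x' + y') :=
    calc (x + y'') + (x' + y') = (x + y') + (x' + y'') := by ac_rfl
      _ ≤ (x' + y) + (x'' + y') := add_le_add h h'
      _ = (x'' + y) + (x' + y') := by ac_rfl
  exact le_of_add_le_add_right key

variable (A) in
/-- The congruence identifying pairs `(x, y)` with the same formal difference `x - y`. -/
def differenceCon : AddCon (A × A) where
  r p q := p.1 + q.2 = q.1 + p.2
  iseqv :=
    { refl := fun _ => rfl
      symm := fun h => h.symm
      trans := fun h h' =>
        le_antisymm (difference_le_trans h.le h'.le) (difference_le_trans h'.ge h.ge) }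
  add' := by
    rintro ⟨x, y⟩ ⟨x', y'⟩ ⟨z, w⟩ ⟨z', w'⟩ h h'
    simp only [Prod.mk_add_mk] at h h' ⊢
    rw [add_add_add_comm, h, h', add_add_add_comm]

variable (A) in
/-- The group of formal differences of a commutative ordered cancellative semigroup. -/
def DifferenceGroup : Type _ := (differenceCon A).Quotient

namespace DifferenceGroup

/-- The formal difference `x - y`. -/
def mk (x y : A) : DifferenceGroup A := Quotient.mk (differenceCon A).toSetoid (x, y)

theorem ind {motive : DifferenceGroup A → Prop} (h : ∀ x y, motive (mk x y)) (g) : motive g :=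
  Quotient.ind (fun p => h p.1 p.2) g

theorem mk_eq_mk {x y x' y' : A} : mk x y = mk x' y' ↔ x + y' = x' + y :=
  Quotient.eq (r := (differenceCon A).toSetoid)

instance : AddCommSemigroup (DifferenceGroup A) :=
  inferInstanceAs (AddCommSemigroup (differenceCon A).Quotient)

theorem mk_add_mk (x y x' y' : A) : mk x y + mk x' y' = mk (x + x') (y + y') := rfl

instance : Neg (DifferenceGroup A) where
  neg := Quotient.lift (fun p => mk p.2 p.1) fun p q h => by
    have h : p.1 + q.2 = q.1 + p.2 := h
    rw [mk_eq_mk, add_comm, ← h, add_comm]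

theorem neg_mk (x y : A) : -mk x y = mk y x := rfl

instance : LE (DifferenceGroup A) where
  le := Quotient.lift₂ (fun p q => p.1 + q.2 ≤ q.1 + p.2) fun p q p' q' h h' => by
    have h : p.1 + p'.2 = p'.1 + p.2 := h
    have h' : q.1 + q'.2 = q'.1 + q.2 := h'
    exact propext
      ⟨fun k => difference_le_trans (difference_le_trans h.ge k) h'.le,
        fun k => difference_le_trans (difference_le_trans h.le k) h'.ge⟩

theorem mk_le_mk {x y x' y' : A} : mk x y ≤ mk x' y' ↔ x + y' ≤ x' + y := Iff.rfl

noncomputable instance : LinearOrder (DifferenceGroup A) where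
  le_refl := ind fun _ _ => le_rfl
  le_trans := ind fun _ _ => ind fun _ _ => ind fun _ _ => difference_le_trans
  le_antisymm := ind fun _ _ => ind fun _ _ h h' => mk_eq_mk.2 (le_antisymm h h')
  le_total := ind fun _ _ => ind fun _ _ => le_total (α := A) _ _
  toDecidableLE := Classical.decRel _

theorem mk_lt_mk {x y x' y' : A} : mk x y < mk x' y' ↔ x + y' < x' + y := by
  rw [← not_le, ← not_le, mk_le_mk]

/-- The canonical map from the semigroup to its group of differences. -/
def of (x : A) : DifferenceGroup A := mk (x + x) x

theorem of_add (x y : A) : of (x + y) = of x + of y := by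
  rw [of, of, of, mk_add_mk, add_add_add_comm]

theorem of_strictMono : StrictMono (of : A → DifferenceGroup A) := by
  intro x y h
  rw [of, of, mk_lt_mk, add_assoc, add_assoc, add_comm y x]
  exact add_lt_add_left h _

variable [Nonempty A]

noncomputable instance : Zero (DifferenceGroup A) where
  zero := mk (Classical.arbitrary A) (Classical.arbitrary A)

theorem mk_self (x : A) : mk x x = 0 := mk_eq_mk.2 (add_comm _ _)

noncomputable instance : AddCommGroup (DifferenceGroup A) :=
  { AddGroup.ofLeftAxioms (G := DifferenceGroup A) add_assoc
      (by
        refine ind fun x y => ?_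
        rw [← mk_self x, mk_add_mk, mk_eq_mk]
        ac_rfl)
      (by
        refine ind fun x y => ?_
        rw [neg_mk, mk_add_mk, add_comm, mk_self]) with
    add_comm := add_comm }

instance : IsOrderedAddMonoid (DifferenceGroup A) where
  add_le_add_left := ind fun x y => ind fun x' y' h => ind fun z w => by
    rw [mk_add_mk, mk_add_mk, mk_le_mk, add_add_add_comm, add_add_add_comm x']
    exact add_le_add_left (mk_le_mk.1 h) _

theorem mk_eq_of_sub_of (x y : A) : mk x y = of x - of y := by
  rw [eq_sub_iff_add_eq, of, of, mk_add_mk, mk_eq_mk]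
  ac_rfl

theorem of_nsm (x : A) (n : ℕ) (hn : 1 ≤ n) : of (nsm x n) = n • of x :=
  map_nsm (B := DifferenceGroup A) (f := of) of_add x n hn

theorem archimedean_of_not_isAddAnomalousPair (hna : ∀ x y : A, ¬ IsAddAnomalousPair x y) :
    Archimedean (DifferenceGroup A) where
  arch := by
    have bounds (x y : A) (h : y < x) :
        ∃ m n : ℕ, of y ≤ m • (of x - of y) ∧ -of x ≤ n • (of x - of y) := by
      have := hna x y
      simp only [IsAddAnomalousPair, h, true_and, not_or, not_forall, not_lt] at this
      obtain ⟨⟨m, hm, hle⟩, n, hn, hle'⟩ := this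
      rw [← of_strictMono.le_iff_le, of_nsm _ _ (by omega), of_nsm _ _ (by omega), succ_nsmul]
        at hle hle'
      refine ⟨m, n, ?_, ?_⟩
      · rw [nsmul_sub]
        exact le_sub_iff_add_le'.2 hle
      · rw [nsmul_sub, neg_le_sub_iff_le_add]
        exact hle'
    refine ind fun p q => @ind _ _ _ _ _ _ fun x y h => ?_
    rw [← mk_self x, mk_lt_mk, add_lt_add_iff_left] at h
    obtain ⟨m, -, hm, -⟩ := bounds (x + p) (y + p) (by gcongr)
    obtain ⟨-, n, -, hn⟩ := bounds (x + q) (y + q) (by gcongr)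
    simp only [of_add, add_sub_add_right_eq_sub] at hm hn
    refine ⟨m + n + 1, ?_⟩
    rw [mk_eq_of_sub_of, mk_eq_of_sub_of, succ_nsmul, add_nsmul]
    calc of p - of q = (of y + of p) + -(of x + of q) + (of x - of y) := by abel
      _ ≤ _ := by gcongr

end DifferenceGroup

end Difference

/-- A non-anomalous ordered semigroup embeds in the reals. -/
theorem exists_strictMono_real {A : Type*} [AddCommSemigroup A] [LinearOrder A] [Nonempty A]
    (hadd : ∀ x y z : A, x < y → x + z < y + z)
    (hna : ∀ x y : A, ¬ IsAddAnomalousPair x y) :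
    ∃ f : A → ℝ, (∀ x y, f (x + y) = f x + f y) ∧ StrictMono f := by
  have hmono (z : A) : StrictMono (z + ·) := fun x y h => by
    simpa only [add_comm z] using hadd x y z h
  have : IsCancelAdd A :=
    { add_left_cancel := fun z _ _ h => (hmono z).injective h
      add_right_cancel := fun z x y h => (hmono z).injective (by
        simpa only [add_comm z] using h) }
  have : AddLeftMono A := ⟨fun z x y h => (hmono z).monotone h⟩
  have := DifferenceGroup.archimedean_of_not_isAddAnomalousPair hna
  obtain ⟨f, hf⟩ := Archimedean.exists_orderAddMonoidHom_real_injective (DifferenceGroup A)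
  exact ⟨fun x => f (.of x), fun x y => by simp only [DifferenceGroup.of_add, map_add],
    (f.monotone'.strictMono_of_injective hf).comp DifferenceGroup.of_strictMono⟩

theorem exists_rat_mul_btwn {r s t : ℝ} (hr : r ≠ 0) (h : s < t) :
    ∃ q : ℚ, s < q * r ∧ q * r < t := by
  rcases hr.lt_or_gt with hr | hr
  · obtain ⟨q, h₁, h₂⟩ := exists_rat_btwn (div_lt_div_of_neg_of_lt hr h)
    exact ⟨q, (lt_div_iff_of_neg hr).1 h₂, (div_lt_iff_of_neg hr).1 h₁⟩
  · obtain ⟨q, h₁, h₂⟩ := exists_rat_btwn (div_lt_div_of_pos_right h hr)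
    exact ⟨q, (div_lt_iff₀ hr).1 h₁, (lt_div_iff₀ hr).1 h₂⟩

theorem exists_nat_mul_sub_eq_rat_mul (q : ℚ) :
    ∃ n m k : ℕ, 1 ≤ n ∧ 1 ≤ m ∧ 1 ≤ k ∧ (n : ℝ) * q = m - k := by
  refine ⟨q.den, q.num.toNat + 1, (-q.num).toNat + 1, q.pos, by omega, by omega, ?_⟩
  have h : ((q.den * q : ℚ) : ℝ) = ((q.num.toNat - (-q.num).toNat : ℤ) : ℝ) := by
    rw [Rat.den_mul_eq_num, Int.toNat_sub_toNat_neg, Rat.cast_intCast]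
  push_cast at h ⊢
  linarith

/-- Additive maps to the reals inducing the same strict order agree as soon as they agree at one
point with nonzero value. -/
theorem eq_of_additive_of_lt_imp_lt {A : Type*} [Add A] {f g : A → ℝ}
    (hf : ∀ x y, f (x + y) = f x + f y) (hg : ∀ x y, g (x + y) = g x + g y)
    (hfg : ∀ x y, f x < f y → g x < g y) {a : A} (hr : f a ≠ 0) (ha : g a = f a) : g = f := by
  have key (x : A) (q : ℚ) :
      (f x < q * f a → g x < q * f a) ∧ (q * f a < f x → q * f a < g x) := by
    obtain ⟨n, m, k, hn, hm, hk, h⟩ := exists_nat_mul_sub_eq_rat_mul q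
    have hlt := hfg (nsm x n + nsm a k) (nsm a m)
    have hgt := hfg (nsm a m) (nsm x n + nsm a k)
    simp only [hf, hg, map_nsm hf _ _ hn, map_nsm hf _ _ hm, map_nsm hf _ _ hk,
      map_nsm hg _ _ hn, map_nsm hg _ _ hm, map_nsm hg _ _ hk, nsmul_eq_mul, ha] at hlt hgt
    have hn' : (0 : ℝ) < n := by exact_mod_cast hn
    have e : n * (q * f a) = m * f a - k * f a := by rw [← mul_assoc, h, sub_mul]
    rw [← mul_lt_mul_iff_right₀ hn', ← mul_lt_mul_iff_right₀ (b := g x) hn',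
      ← mul_lt_mul_iff_right₀ (c := f x) hn', ← mul_lt_mul_iff_right₀ (c := g x) hn', e]
    exact ⟨fun h => by linarith [hlt (by linarith)], fun h => by linarith [hgt (by linarith)]⟩
  funext x
  rcases lt_trichotomy (f x) (g x) with h | h | h
  · obtain ⟨q, h₁, h₂⟩ := exists_rat_mul_btwn hr h
    exact absurd ((key x q).1 h₁) h₂.not_gt
  · exact h.symm
  · obtain ⟨q, h₁, h₂⟩ := exists_rat_mul_btwn hr h
    exact absurd ((key x q).2 h₂) h₁.not_gt

/-- `(ℝ, r)` is terminal among pointed non-anomalous commutative totally ordered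
additive semigroups: for a non-anomalous semigroup `A`, a non-identity `a ∈ A` and a
nonzero real `r`, there is exactly one morphism `f : A → ℝ` with `f a = r`. -/
theorem stmt10 {A : Type*} [AddCommSemigroup A] [LinearOrder A]
    (hadd : ∀ x y z : A, x < y → x + z < y + z)
    (hna : ∀ x y : A, ¬ IsAddAnomalousPair x y)
    (a : A) (ha : a + a ≠ a) (r : ℝ) (hr : r ≠ 0) :
    ∃! f : A → ℝ, IsMorphism f ∧ f a = r := by
  have : Nonempty A := ⟨a⟩
  obtain ⟨φ, hφ, hmono⟩ := exists_strictMono_real hadd hna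
  have hne : φ a ≠ 0 := fun h => ha (hmono.injective (by rw [hφ, h, add_zero]))
  have hmor : IsMorphism fun x => r / φ a * φ x := by
    refine ⟨fun x y => by simp only [hφ, mul_add], ?_⟩
    rcases (div_ne_zero hr hne).lt_or_gt with hc | hc
    · exact .inr fun x y h => mul_lt_mul_of_neg_left (hmono h) hc
    · exact .inl fun x y h => mul_lt_mul_of_pos_left (hmono h) hc
  refine ⟨_, ⟨hmor, div_mul_cancel₀ r hne⟩, ?_⟩
  rintro g ⟨⟨hg, hg'⟩, hga⟩
  have direction {f : A → ℝ} (hf : ∀ x y, f (x + y) = f x + f y) (hfa : f a = r) :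
      (StrictMono f → (a < a + a ↔ 0 < r)) ∧ (StrictAnti f → (a < a + a ↔ r < 0)) :=
    ⟨fun h => by rw [← h.lt_iff_lt, hf, hfa, lt_add_iff_pos_right],
      fun h => by rw [← h.lt_iff_gt, hf, hfa, add_lt_iff_neg_left]⟩
  obtain ⟨hf, hf'⟩ := hmor
  have hfa : r / φ a * φ a = r := div_mul_cancel₀ r hne
  refine eq_of_additive_of_lt_imp_lt hf hg (fun x y h => ?_) (hfa.trans_ne hr)
    (hga.trans hfa.symm)
  have df := direction (f := fun x => r / φ a * φ x) hf hfa
  have dg := direction hg hga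
  rcases hf' with hf' | hf' <;> rcases hg' with hg' | hg'
  · exact hg' (hf'.lt_iff_lt.1 h)
  · have := (df.1 hf').symm.trans (dg.2 hg')
    grind
  · have := (df.2 hf').symm.trans (dg.1 hg')
    grind
  · exact hg' (hf'.lt_iff_gt.1 h)
end
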